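/- arXiv:1605.02728 — 3 statements merged into one kernel-verified Lean document; each statement's English description precedes it below -/
import Mathlib

section
/- For 0 < q < 1, 1/((q²;q⁵)_∞(q³;q⁵)_∞) = (-q³;q²)_∞ ∑_{n=0}^∞ q^{n²+n} / ((q²;q²)_n (-q³;q²)_n). -/
noncomputable def qp (q a : ℝ) (n : ℕ) : ℝ := ∏ k ∈ Finset.range n, (1 - a * q ^ k)

noncomputable def qpi (q a : ℝ) : ℝ := ∏' k : ℕ, (1 - a * q ^ k)

open Finset Filter Topology

noncomputable def gb (q : ℝ) : ℕ → ℕ → ℝ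
  | _, 0 => 1
  | 0, _ + 1 => 0
  | n + 1, k + 1 => q ^ (k + 1) * gb q n (k + 1) + gb q n k

lemma gb_zero_right (q : ℝ) (n : ℕ) : gb q n 0 = 1 := by
  cases n <;> simp [gb]

lemma gb_succ (q : ℝ) (n k : ℕ) :
    gb q (n + 1) (k + 1) = q ^ (k + 1) * gb q n (k + 1) + gb q n k := by
  simp [gb]

lemma gb_big (q : ℝ) (n k : ℕ) (h : n < k) : gb q n k = 0 := by
  induction n generalizing k with
  | zero => cases k with
    | zero => omega
    | succ k => simp [gb]
  | succ n ih => cases k with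
    | zero => omega
    | succ k => rw [gb_succ, ih _ (by omega), ih _ (by omega)]; simp

lemma qp_succ (q a : ℝ) (n : ℕ) : qp q a (n + 1) = qp q a n * (1 - a * q ^ n) := by
  simp [qp, prod_range_succ]

lemma qp_zero (q a : ℝ) : qp q a 0 = 1 := by simp [qp]

lemma qq_succ (q : ℝ) (n : ℕ) : qp q q (n + 1) = qp q q n * (1 - q ^ (n + 1)) := by
  rw [qp_succ, pow_succ']

lemma qp_pos (q a : ℝ) (h0 : 0 < q) (h1 : q < 1) (ha : a < 1) (n : ℕ) : 0 < qp q a n := by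
  unfold qp
  apply prod_pos
  intro k _
  have h2 : q ^ k ≤ 1 := pow_le_one₀ h0.le h1.le
  have h3 : 0 < q ^ k := by positivity
  nlinarith

lemma gb_mul (q : ℝ) (k m : ℕ) : gb q (k + m) k * (qp q q k * qp q q m) = qp q q (k + m) := by
  induction k generalizing m with
  | zero => simp [gb_zero_right, qp_zero]
  | succ k ihk =>
    induction m with
    | zero =>
      have := ihk 0
      rw [show k + 1 + 0 = k + 1 from rfl, gb_succ, gb_big _ _ _ (by omega), qq_succ]
      simp only [add_zero] at this
      linear_combination (1 - q ^ (k + 1)) * this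
    | succ m ihm =>
      have h1 := ihk (m + 1)
      rw [show k + 1 + (m + 1) = (k + 1 + m) + 1 by omega, gb_succ, qq_succ q (k + 1 + m)]
      rw [show k + (m + 1) = k + 1 + m by omega] at h1
      rw [qq_succ q m] at h1 ⊢
      rw [qq_succ q k] at ihm ⊢
      have e : q ^ (k + 1 + m + 1) = q ^ (k + 1) * q ^ (m + 1) := by ring
      rw [e]
      linear_combination (1 - q ^ (k + 1)) * h1 + q ^ (k + 1) * (1 - q ^ (m + 1)) * ihm

lemma gb_eq (q : ℝ) (h0 : 0 < q) (h1 : q < 1) (n k : ℕ) (h : k ≤ n) :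
    gb q n k = qp q q n / (qp q q k * qp q q (n - k)) := by
  have a := gb_mul q k (n - k)
  rw [Nat.add_sub_cancel' h] at a
  have p1 := qp_pos q q h0 h1 h1 k
  have p2 := qp_pos q q h0 h1 h1 (n - k)
  rw [← a]
  field_simp

lemma pascal_sum (q : ℝ) (N : ℕ) (f : ℕ → ℝ) :
    ∑ k ∈ range (N + 2), gb q (N + 1) k * f k =
      ∑ k ∈ range (N + 1), q ^ k * gb q N k * f k
        + ∑ k ∈ range (N + 1), gb q N k * f (k + 1) := by
  rw [sum_range_succ']
  simp only [gb_succ, add_mul, sum_add_distrib, gb_zero_right]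
  have : ∑ k ∈ range (N + 1), q ^ k * gb q N k * f k =
      ∑ k ∈ range (N + 2), q ^ k * gb q N k * f k := by
    rw [sum_range_succ _ (N + 1), gb_big q N (N + 1) (by omega)]; simp
  rw [this, sum_range_succ' _ (N + 1), gb_zero_right]
  simp; ring

lemma choose_two_succ (k : ℕ) : (k + 1).choose 2 = k.choose 2 + k := by
  rw [Nat.choose_succ_succ' k 1]; simp; ring

lemma q_binom (q a b : ℝ) (N : ℕ) :
    ∑ k ∈ range (N + 1), gb q N k * ((-1) ^ k * q ^ (k.choose 2) * b ^ k * a ^ (N - k)) =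
      ∏ k ∈ range N, (a - b * q ^ k) := by
  induction N generalizing b with
  | zero => simp [gb_zero_right]
  | succ N ih =>
    rw [pascal_sum, prod_range_succ']
    have h := ih (b * q)
    have e1 : ∏ k ∈ range N, (a - b * q ^ (k + 1)) = ∏ k ∈ range N, (a - b * q * q ^ k) :=
      prod_congr rfl fun k _ => by ring
    rw [e1, ← h, sum_mul, ← sum_add_distrib]
    apply sum_congr rfl
    intro k hk
    have hk' : k ≤ N := by simp at hk; omega
    rw [show N + 1 - k = (N - k) + 1 by omega, show N + 1 - (k + 1) = N - k by omega,
      choose_two_succ]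
    ring

lemma rogers_szego (q : ℝ) (h0 : 0 < q) (h1 : q < 1) (N : ℕ) :
    ∑ k ∈ range (N + 1), gb (q ^ 2) N k * q ^ k = ∏ k ∈ range N, (1 + q ^ (k + 1)) := by
  have h0' : 0 < q ^ 2 := by positivity
  have h1' : q ^ 2 < 1 := by nlinarith
  have sym : ∀ N, ∑ k ∈ range (N + 1), gb (q ^ 2) N k * q ^ k =
      ∑ k ∈ range (N + 1), gb (q ^ 2) N k * q ^ (N - k) := by
    intro N
    rw [← sum_range_reflect]
    apply sum_congr rfl
    intro k hk
    have hk' : k ≤ N := by simp at hk; omega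
    rw [show N + 1 - 1 - k = N - k by omega, gb_eq _ h0' h1' _ _ hk',
      gb_eq _ h0' h1' _ (N - k) (by omega), show N - (N - k) = k by omega]
    ring
  induction N with
  | zero => simp [gb_zero_right]
  | succ N ih =>
    rw [sym (N + 1), pascal_sum, prod_range_succ, ← ih, mul_add, mul_one, sum_mul, add_comm]
    congr 1
    · rw [sym N]
      apply sum_congr rfl
      intro k hk
      rw [show N + 1 - (k + 1) = N - k by omega]
    · apply sum_congr rfl
      intro k hk
      have hk' : k ≤ N := by simp at hk; omega
      obtain ⟨m, rfl⟩ := Nat.exists_eq_add_of_le hk'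
      rw [show k + m + 1 - k = m + 1 by omega]
      ring

lemma vander (q : ℝ) (h0 : 0 < q) (h1 : q < 1) (M s : ℕ) :
    ∑ i ∈ range (M + 1), gb q M i * (q ^ (i ^ 2 + i * s) / qp q q (i + s)) =
      1 / qp q q (M + s) := by
  induction M generalizing s with
  | zero => simp [gb_zero_right]
  | succ M ih =>
    rw [pascal_sum, ← sum_add_distrib, show M + 1 + s = M + (s + 1) by omega, ← ih (s + 1)]
    apply sum_congr rfl
    intro i _
    have p1 := qp_pos q q h0 h1 h1 (i + s)
    have p2 := qp_pos q q h0 h1 h1 (i + s + 1)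
    rw [show i + 1 + s = i + s + 1 by omega, show i + (s + 1) = i + s + 1 by omega]
    rw [qq_succ] at p2 ⊢
    have p3 : 0 < 1 - q ^ (i + s + 1) := by
      have := pow_lt_one₀ h0.le h1 (n := i + s + 1) (by omega)
      linarith
    field_simp
    ring

lemma vander' (q : ℝ) (h0 : 0 < q) (h1 : q < 1) (N r : ℕ) (h : r ≤ N) :
    ∑ j ∈ Ico r (N + 1), q ^ (j ^ 2 + j) / (qp q q (N - j) * (qp q q (j - r) * qp q q (j + r + 1)))
     = q ^ (r ^ 2 + r) / (qp q q (N - r) * qp q q (N + r + 1)) := by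
  obtain ⟨M, rfl⟩ := Nat.exists_eq_add_of_le h
  have v := vander q h0 h1 M (2 * r + 1)
  rw [sum_Ico_eq_sum_range, show r + M + 1 - r = M + 1 by omega, show r + M - r = M by omega,
    show r + M + r + 1 = M + (2 * r + 1) by omega]
  have p1 := qp_pos q q h0 h1 h1 M
  have : q ^ (r ^ 2 + r) / (qp q q M * qp q q (M + (2 * r + 1))) =
     q ^ (r ^ 2 + r) / qp q q M * (1 / qp q q (M + (2 * r + 1))) := by
    field_simp
  rw [this, ← v, mul_sum]
  apply sum_congr rfl
  intro i hi
  have hk' : i ≤ M := by simp at hi; omega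
  rw [gb_eq _ h0 h1 _ _ hk', show r + M - (r + i) = M - i by omega, show r + i - r = i by omega,
    show r + i + r + 1 = i + (2 * r + 1) by omega]
  have p2 := qp_pos q q h0 h1 h1 (M - i)
  have p3 := qp_pos q q h0 h1 h1 i
  have p4 := qp_pos q q h0 h1 h1 (i + (2 * r + 1))
  field_simp
  ring

lemma bailey (q : ℝ) (h0 : 0 < q) (h1 : q < 1) (α : ℕ → ℝ) (N : ℕ) :
    ∑ j ∈ range (N + 1), q ^ (j ^ 2 + j) / qp q q (N - j) *
      (∑ r ∈ range (j + 1), α r / (qp q q (j - r) * qp q q (j + r + 1))) =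
    ∑ r ∈ range (N + 1), q ^ (r ^ 2 + r) * α r / (qp q q (N - r) * qp q q (N + r + 1)) := by
  simp_rw [mul_sum]
  rw [sum_comm' (t' := range (N + 1)) (s' := fun r => Ico r (N + 1))
    (by intro x y; simp only [mem_range, mem_Ico]; omega)]
  apply sum_congr rfl
  intro r hr
  have hk' : r ≤ N := by simp at hr; omega
  have v := vander' q h0 h1 N r hk'
  rw [mul_comm (q ^ _), mul_div_assoc, ← v, mul_sum]
  apply sum_congr rfl
  intro j _
  rw [div_mul_div_comm, mul_div_assoc', mul_comm (α r)]

lemma unit_partial (q : ℝ) (h0 : 0 < q) (h1 : q < 1) (R m : ℕ) :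
    ∑ r ∈ range (R + 1), (-1) ^ r * q ^ (r.choose 2) * (1 - q ^ (2 * r + 1)) /
      (qp q q (R + m + 1 - r) * qp q q (R + m + 1 + r + 1)) =
    (-1) ^ R * q ^ ((R + 1).choose 2) * (1 - q ^ (R + 1)) /
      ((1 - q ^ (R + m + 1)) * qp q q m * qp q q (R + m + 1 + R + 1)) := by
  have pp : ∀ n, 0 < 1 - q ^ (n + 1) := fun n => by
      have := pow_lt_one₀ h0.le h1 (n := n + 1) (by omega)
      linarith
  induction R generalizing m with
  | zero =>
    simp
    rw [qq_succ q m]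
    have := pp m
    have p1 := qp_pos q q h0 h1 h1 m
    have p4 := qp_pos q q h0 h1 h1 (m + 1 + 1)
    field_simp
  | succ R ih =>
    have ih' := ih (m + 1)
    rw [show R + (m + 1) + 1 = R + 1 + m + 1 by omega] at ih'
    rw [sum_range_succ, ih', show R + 1 + m + 1 - (R + 1) = m + 1 by omega,
      show R + 1 + m + 1 + (R + 1) + 1 = (R + 1 + m + 1 + R + 1) + 1 by omega]
    rw [qq_succ q m, qq_succ q (R + 1 + m + 1 + R + 1), choose_two_succ (R + 1)]
    have p1 := qp_pos q q h0 h1 h1 m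
    have p2 := qp_pos q q h0 h1 h1 (R + 1 + m + 1 + R + 1)
    have p3 := pp m
    have p4 := pp (R + 1 + m)
    have p5 := pp (R + 1 + m + 1 + R + 1)
    field_simp
    ring

lemma unit_sum (q : ℝ) (h0 : 0 < q) (h1 : q < 1) (j : ℕ) :
    ∑ r ∈ range (j + 1), (-1) ^ r * q ^ (r.choose 2) * (1 - q ^ (2 * r + 1)) /
      (qp q q (j - r) * qp q q (j + r + 1)) = if j = 0 then 1 else 0 := by
  cases j with
  | zero =>
    have : 1 - q ≠ 0 := by linarith
    simp [qp, this]
  | succ j =>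
    rw [sum_range_succ]
    have := unit_partial q h0 h1 j 0
    simp only [add_zero] at this
    rw [this, qq_succ q (j + 1 + (j + 1))]
    have p2 := qp_pos q q h0 h1 h1 (j + 1 + (j + 1))
    have pp : ∀ n, 0 < 1 - q ^ (n + 1) := fun n => by
      have := pow_lt_one₀ h0.le h1 (n := n + 1) (by omega)
      linarith
    have p3 := pp j
    have p4 := pp (j + 1 + (j + 1))
    simp only [show j + 1 + j + 1 = j + 1 + (j + 1) by omega, Nat.sub_self, qp_zero]
    rw [show 2 * (j + 1) + 1 = j + 1 + (j + 1) + 1 by omega]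
    simp
    field_simp
    ring

lemma sq_choose (r : ℕ) : r ^ 2 = 2 * r.choose 2 + r := by
  induction r with
  | zero => simp
  | succ r ih => rw [choose_two_succ]; linarith

/-- finite Rogers-Ramanujan -/
lemma finite_rr (q : ℝ) (h0 : 0 < q) (h1 : q < 1) (N : ℕ) :
    ∑ j ∈ range (N + 1), q ^ (j ^ 2 + j) / (qp q q j * qp q q (N - j)) =
    ∑ r ∈ range (N + 1), (-1) ^ r * q ^ (5 * r.choose 2 + 4 * r) * (1 - q ^ (2 * r + 1)) /
      (qp q q (N - r) * qp q q (N + r + 1)) := by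
  have b1 : ∀ N, 1 / qp q q N = _ := fun N => by
    have := bailey q h0 h1 (fun r => (-1) ^ r * q ^ (r.choose 2) * (1 - q ^ (2 * r + 1))) N
    simp only [unit_sum q h0 h1] at this
    simpa using this
  have b2 := bailey q h0 h1 (fun r => q ^ (r ^ 2 + r) *
    ((-1) ^ r * q ^ (r.choose 2) * (1 - q ^ (2 * r + 1)))) N
  simp only [← b1] at b2
  convert b2 using 1
  · apply sum_congr rfl
    intro j _
    rw [div_mul_div_comm, mul_one, mul_comm (qp q q j)]
  · apply sum_congr rfl
    intro r _
    congr 1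
    rw [sq_choose]
    ring

lemma qp_sq (q : ℝ) (N : ℕ) :
    qp (q ^ 2) (q ^ 2) N = qp q q N * ∏ k ∈ range N, (1 + q ^ (k + 1)) := by
  unfold qp
  rw [← prod_mul_distrib]
  exact prod_congr rfl fun k _ => by ring

lemma inv_qq (q : ℝ) (h0 : 0 < q) (h1 : q < 1) (N : ℕ) :
    1 / qp q q N = ∑ k ∈ range (N + 1),
      q ^ k / (qp (q ^ 2) (q ^ 2) k * qp (q ^ 2) (q ^ 2) (N - k)) := by
  have h0' : 0 < q ^ 2 := by positivity
  have h1' : q ^ 2 < 1 := by nlinarith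
  have p1 := qp_pos q q h0 h1 h1 N
  have p2 := qp_pos (q ^ 2) (q ^ 2) h0' h1' h1' N
  have : 1 / qp q q N = (∏ k ∈ range N, (1 + q ^ (k + 1))) / qp (q ^ 2) (q ^ 2) N := by
    rw [div_eq_div_iff p1.ne' p2.ne', qp_sq]; ring
  rw [this, ← rogers_szego q h0 h1, sum_div]
  apply sum_congr rfl
  intro k hk
  have hk' : k ≤ N := by simp at hk; omega
  rw [gb_eq _ h0' h1' _ _ hk']
  have p3 := qp_pos (q ^ 2) (q ^ 2) h0' h1' h1' k
  have p4 := qp_pos (q ^ 2) (q ^ 2) h0' h1' h1' (N - k)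
  field_simp

lemma qp_tail (q : ℝ) (h0 : 0 < q) (h1 : q < 1) (n K : ℕ) :
    qp (q ^ 2) (-q ^ 3) (n + K) / qp (q ^ 2) (-q ^ 3) n / qp (q ^ 2) (q ^ 2) K =
    ∑ k ∈ range (K + 1), q ^ (k ^ 2 + 2 * k + 2 * n * k) /
      (qp (q ^ 2) (q ^ 2) k * qp (q ^ 2) (q ^ 2) (K - k)) := by
  have h0' : 0 < q ^ 2 := by positivity
  have h1' : q ^ 2 < 1 := by nlinarith
  have hx : -q ^ 3 < 1 := by have : 0 < q ^ 3 := by positivity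
                             linarith
  have p1 := qp_pos (q ^ 2) (-q ^ 3) h0' h1' hx n
  have e : qp (q ^ 2) (-q ^ 3) (n + K) / qp (q ^ 2) (-q ^ 3) n =
      ∏ k ∈ range K, (1 - (-q ^ 3 * (q ^ 2) ^ n) * (q ^ 2) ^ k) := by
    rw [div_eq_iff p1.ne']
    unfold qp
    rw [prod_range_add, mul_comm]
    congr 1
    exact prod_congr rfl fun k _ => by ring
  rw [e, ← q_binom, sum_div]
  apply sum_congr rfl
  intro k hk
  have hk' : k ≤ K := by simp at hk; omega
  rw [gb_eq _ h0' h1' _ _ hk']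
  have p2 := qp_pos (q ^ 2) (q ^ 2) h0' h1' h1' K
  have p3 := qp_pos (q ^ 2) (q ^ 2) h0' h1' h1' k
  have p4 := qp_pos (q ^ 2) (q ^ 2) h0' h1' h1' (K - k)
  have e2 : (-1 : ℝ) ^ k * (q ^ 2) ^ k.choose 2 * (-q ^ 3 * (q ^ 2) ^ n) ^ k * 1 ^ (K - k) =
      q ^ (k ^ 2 + 2 * k + 2 * n * k) := by
    rw [sq_choose, neg_mul, neg_pow (q ^ 3 * (q ^ 2) ^ n)]
    have : (-1 : ℝ) ^ k * (-1) ^ k = 1 := by rw [← mul_pow]; simp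
    calc _ = ((-1 : ℝ) ^ k * (-1) ^ k) * ((q ^ 2) ^ k.choose 2 * (q ^ 3 * (q ^ 2) ^ n) ^ k) := by
          rw [one_pow]; ring
      _ = _ := by rw [this]; ring
  rw [e2]
  field_simp

lemma finite_step (q : ℝ) (h0 : 0 < q) (h1 : q < 1) (M : ℕ) :
    ∑ n ∈ range (M + 1), q ^ (n ^ 2 + n) / (qp (q ^ 2) (q ^ 2) n * qp (q ^ 2) (-q ^ 3) n) *
      (1 / qp (q ^ 2) (q ^ 2) (M - n)) * qp (q ^ 2) (-q ^ 3) M =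
    ∑ N ∈ range (M + 1), q ^ (N ^ 2 + N) / qp q q N * (1 / qp (q ^ 2) (q ^ 2) (M - N)) := by
  have l : ∀ n ∈ range (M + 1),
      q ^ (n ^ 2 + n) / (qp (q ^ 2) (q ^ 2) n * qp (q ^ 2) (-q ^ 3) n) *
      (1 / qp (q ^ 2) (q ^ 2) (M - n)) * qp (q ^ 2) (-q ^ 3) M =
      ∑ k ∈ range (M - n + 1), q ^ (n ^ 2 + n) / qp (q ^ 2) (q ^ 2) n *
       (q ^ (k ^ 2 + 2 * k + 2 * n * k) /
      (qp (q ^ 2) (q ^ 2) k * qp (q ^ 2) (q ^ 2) (M - n - k))) := by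
    intro n hn
    have hk' : n ≤ M := by simp at hn; omega
    rw [← mul_sum, ← qp_tail q h0 h1, Nat.add_sub_cancel' hk']
    simp only [div_eq_mul_inv, mul_inv]
    ring
  have r : ∀ N ∈ range (M + 1),
      q ^ (N ^ 2 + N) / qp q q N * (1 / qp (q ^ 2) (q ^ 2) (M - N)) =
      ∑ k ∈ range (N + 1), q ^ (N ^ 2 + N) * (1 / qp (q ^ 2) (q ^ 2) (M - N)) *
       (q ^ k / (qp (q ^ 2) (q ^ 2) k * qp (q ^ 2) (q ^ 2) (N - k))) := by
    intro N _
    rw [← mul_sum, ← inv_qq q h0 h1]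
    ring
  rw [sum_congr rfl l, sum_congr rfl r]
  rw [sum_comm' (t' := range (M + 1)) (s' := fun r => range (M + 1 - r))
    (by intro x y; simp only [mem_range]; omega)]
  symm
  rw [sum_comm' (t' := range (M + 1)) (s' := fun r => Ico r (M + 1))
    (by intro x y; simp only [mem_range, mem_Ico]; omega)]
  symm
  apply sum_congr rfl
  intro k _
  rw [sum_Ico_eq_sum_range]
  apply sum_congr rfl
  intro n _
  rw [show M - (k + n) = M - n - k by omega, show k + n - k = n by omega]
  simp only [div_eq_mul_inv, mul_inv]
  ring

lemma prod_first (q : ℝ) (n : ℕ) :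
    ∏ k ∈ range n, ((q ^ 5) ^ n - q * (q ^ 5) ^ k) =
      (-1) ^ n * q ^ n * (q ^ 5) ^ (n.choose 2) * qp (q ^ 5) (q ^ 4) n := by
  have e : (q ^ 5) ^ (n.choose 2) = ∏ k ∈ range n, (q ^ 5) ^ (n - 1 - k) := by
    rw [prod_range_reflect (fun k => (q ^ 5) ^ k), prod_pow_eq_pow_sum, sum_range_id,
      Nat.choose_two_right]
  have e2 : (-1) ^ n * q ^ n = ∏ k ∈ range n, (-q) := by
    rw [prod_const, card_range, neg_pow q]
  rw [← prod_range_reflect, e, e2, qp, ← prod_mul_distrib, ← prod_mul_distrib]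
  apply prod_congr rfl
  intro k hk
  simp only [mem_range] at hk
  obtain ⟨m, rfl⟩ := Nat.exists_eq_add_of_lt hk
  rw [show k + m + 1 - 1 - k = m by omega]
  ring

lemma choose_add (a b : ℕ) : (a + b).choose 2 = a.choose 2 + b.choose 2 + a * b := by
  induction b with
  | zero => simp
  | succ b ih => rw [← add_assoc, choose_two_succ, choose_two_succ, ih]; ring

lemma finite_jtp (q : ℝ) (h0 : 0 < q) (h1 : q < 1) (n : ℕ) :
    qp (q ^ 5) q (n + 1) * qp (q ^ 5) (q ^ 4) n / qp (q ^ 5) (q ^ 5) (2 * n + 1) =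
    ∑ r ∈ range (n + 1), (-1) ^ r * q ^ (5 * r.choose 2 + 4 * r) * (1 - q ^ (2 * r + 1)) /
      (qp (q ^ 5) (q ^ 5) (n - r) * qp (q ^ 5) (q ^ 5) (n + r + 1)) := by
  have h0' : 0 < q ^ 5 := by positivity
  have h1' : q ^ 5 < 1 := pow_lt_one₀ h0.le h1 (by omega)
  have b := q_binom (q ^ 5) ((q ^ 5) ^ n) q (n + (n + 1))
  have e : ∏ k ∈ range (n + 1), ((q ^ 5) ^ n - q * (q ^ 5) ^ (n + k)) =
      (q ^ 5) ^ (n * (n + 1)) * qp (q ^ 5) q (n + 1) := by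
    have e2 : (q ^ 5) ^ (n * (n + 1)) = ∏ k ∈ range (n + 1), (q ^ 5) ^ n := by
      rw [prod_const, card_range, pow_mul]
    rw [e2, qp, ← prod_mul_distrib]
    exact prod_congr rfl fun k _ => by ring
  rw [prod_range_add, prod_first, e, show n + (n + 1) + 1 = (n + 1) + (n + 1) by omega,
    sum_range_add, ← sum_range_reflect, ← sum_add_distrib] at b
  have p2 := qp_pos (q ^ 5) (q ^ 5) h0' h1' h1' (2 * n + 1)
  have c : ((-1) ^ n * q ^ n * (q ^ 5) ^ (n.choose 2) * (q ^ 5) ^ (n * (n + 1))) ≠ 0 := by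
    have : (-1 : ℝ) ^ n ≠ 0 := by simp
    positivity
  rw [div_eq_iff p2.ne']
  apply mul_left_cancel₀ c
  rw [sum_mul, mul_sum]
  refine Eq.trans ?_ (b.symm.trans ?_)
  · ring
  apply sum_congr rfl
  intro r hr
  have hk' : r ≤ n := by simp at hr; omega
  obtain ⟨m, rfl⟩ := Nat.exists_eq_add_of_le hk'
  rw [show r + m + 1 - 1 - r = m by omega, gb_eq _ h0' h1' _ _ (by omega),
    gb_eq _ h0' h1' _ _ (by omega), show r + m + (r + m + 1) - m = r + m + r + 1 by omega,
    show r + m + (r + m + 1) - (r + m + 1 + r) = m by omega, show r + m - r = m by omega,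
    show r + m + (r + m + 1) = 2 * (r + m) + 1 by omega,
    show r + m + 1 + r = r + m + r + 1 by omega]
  have p3 := qp_pos (q ^ 5) (q ^ 5) h0' h1' h1' m
  have p4 := qp_pos (q ^ 5) (q ^ 5) h0' h1' h1' (r + m + r + 1)
  have s : (-1 : ℝ) ^ r * (-1) ^ r = 1 := by rw [← mul_pow]; simp
  have t1 : (-1 : ℝ) ^ (r + m) * (-1) ^ r = (-1) ^ m := by
    rw [pow_add]; linear_combination (-1 : ℝ) ^ m * s
  have t2 : (-1 : ℝ) ^ (r + m + r + 1) = - (-1) ^ m := by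
    rw [pow_add, pow_add, t1]; simp
  have u : (-1 : ℝ) ^ (r + m) * q ^ (r + m) * (q ^ 5) ^ (r + m).choose 2 *
      (q ^ 5) ^ ((r + m) * (r + m + 1)) *
      ((-1) ^ r * q ^ (5 * r.choose 2 + 4 * r) * (1 - q ^ (2 * r + 1))) =
      (-1) ^ m * (q ^ 5) ^ m.choose 2 * q ^ m * ((q ^ 5) ^ (r + m)) ^ (r + m + r + 1) +
      (-1) ^ (r + m + r + 1) * (q ^ 5) ^ (r + m + r + 1).choose 2 * q ^ (r + m + r + 1) *
        ((q ^ 5) ^ (r + m)) ^ m := by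
    rw [t2, ← t1, choose_two_succ, choose_add (r + m) r, choose_add r m]
    ring_nf
    have := sq_choose r
    rw [this]
    ring
  generalize (-1 : ℝ) ^ m * (q ^ 5) ^ m.choose 2 * q ^ m *
    ((q ^ 5) ^ (r + m)) ^ (r + m + r + 1) = X at *
  generalize (-1) ^ (r + m + r + 1) * (q ^ 5) ^ (r + m + r + 1).choose 2 * q ^ (r + m + r + 1) *
        ((q ^ 5) ^ (r + m)) ^ m = Y at *
  generalize (-1 : ℝ) ^ (r + m) * q ^ (r + m) * (q ^ 5) ^ (r + m).choose 2 *
      (q ^ 5) ^ ((r + m) * (r + m + 1)) = Z at *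
  generalize (-1) ^ r * q ^ (5 * r.choose 2 + 4 * r) * (1 - q ^ (2 * r + 1)) = W at *
  field_simp
  rw [u]

lemma summ_pow (q a : ℝ) (h0 : 0 < q) (h1 : q < 1) : Summable (fun k : ℕ => ‖-(a * q ^ k)‖) := by
  have := (summable_geometric_of_lt_one h0.le h1).mul_left |a|
  refine this.congr fun k => ?_
  rw [norm_neg, norm_mul, Real.norm_eq_abs, Real.norm_eq_abs, abs_of_pos (pow_pos h0 k)]

lemma qp_tendsto (q a : ℝ) (h0 : 0 < q) (h1 : q < 1) :
    Tendsto (fun n => qp q a n) atTop (𝓝 (qpi q a)) := by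
  have m := multipliable_one_add_of_summable (summ_pow q a h0 h1)
  have := m.hasProd.tendsto_prod_nat
  simp only [← sub_eq_add_neg] at this
  exact this

lemma qpi_ne (q a : ℝ) (h0 : 0 < q) (h1 : q < 1) (ha : a < 1) : qpi q a ≠ 0 := by
  have := tprod_one_add_ne_zero_of_summable (f := fun k : ℕ => -(a * q ^ k)) (by
    intro k
    have h2 : q ^ k ≤ 1 := pow_le_one₀ h0.le h1.le
    have h3 : 0 < q ^ k := by positivity
    have : 0 < 1 + -(a * q ^ k) := by nlinarith
    exact this.ne') (summ_pow q a h0 h1)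
  simp only [← sub_eq_add_neg] at this
  exact this

lemma inv_tendsto (q a : ℝ) (h0 : 0 < q) (h1 : q < 1) (ha : a < 1) :
    Tendsto (fun n => 1 / qp q a n) atTop (𝓝 (1 / qpi q a)) :=
  tendsto_const_nhds.div (qp_tendsto q a h0 h1) (qpi_ne q a h0 h1 ha)

lemma bdd_of_tendsto (u : ℕ → ℝ) (U : ℝ) (h : Tendsto u atTop (𝓝 U)) : ∃ C, ∀ n, ‖u n‖ ≤ C := by
  obtain ⟨C, hC⟩ := (Metric.isBounded_range_of_tendsto u h).exists_norm_le
  exact ⟨C, fun n => hC _ ⟨n, rfl⟩⟩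

lemma tann (f u v : ℕ → ℝ) (U V : ℝ) (e : ℕ → ℕ) (hf : Summable f)
    (hu : Tendsto u atTop (𝓝 U)) (hv : Tendsto v atTop (𝓝 V)) :
    Tendsto (fun n => ∑ r ∈ range (n + 1), f r * u (n - r) * v (n + e r)) atTop
      (𝓝 ((∑' r, f r) * U * V)) := by
  obtain ⟨C, hC⟩ := bdd_of_tendsto u U hu
  obtain ⟨D, hD⟩ := bdd_of_tendsto v V hv
  have hC0 : 0 ≤ C := (norm_nonneg _).trans (hC 0)
  have key := tendsto_tsum_of_dominated_convergence (𝓕 := atTop)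
    (f := fun n r => if r ∈ range (n + 1) then f r * u (n - r) * v (n + e r) else 0)
    (g := fun r => f r * U * V) (bound := fun r => ‖f r‖ * C * D)
    ((hf.norm.mul_right C).mul_right D) (by
      intro r
      have t1 : Tendsto (fun n => f r * u (n - r) * v (n + e r)) atTop (𝓝 (f r * U * V)) :=
        (tendsto_const_nhds.mul (hu.comp (tendsto_sub_atTop_nat r))).mul
          (hv.comp (tendsto_add_atTop_nat (e r)))
      refine t1.congr' ?_
      filter_upwards [eventually_ge_atTop r] with n hn
      rw [if_pos (by simp; omega)]) (by
      refine Eventually.of_forall fun n r => ?_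
      have b0 : 0 ≤ ‖f r‖ * C * D :=
        mul_nonneg (mul_nonneg (norm_nonneg _) hC0) ((norm_nonneg _).trans (hD 0))
      split_ifs
      · rw [norm_mul, norm_mul]
        have := hC (n - r)
        have := hD (n + e r)
        gcongr
      · simpa using b0)
  rw [tsum_mul_right, tsum_mul_right] at key
  refine key.congr fun n => ?_
  rw [tsum_eq_sum (s := range (n + 1)) (fun r hr => if_neg hr)]
  exact sum_congr rfl fun r hr => if_pos hr

lemma summ_of_bdd (q : ℝ) (h0 : 0 < q) (h1 : q < 1) (E : ℕ → ℕ) (hE : ∀ n, n ≤ E n) (w : ℕ → ℝ)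
    (C : ℝ) (hw : ∀ n, ‖w n‖ ≤ C) : Summable (fun n => q ^ (E n) * w n) := by
  refine Summable.of_norm_bounded ((summable_geometric_of_lt_one h0.le h1).mul_right C) fun n => ?_
  rw [norm_mul, norm_pow, Real.norm_of_nonneg h0.le]
  have := pow_le_pow_of_le_one h0.le h1.le (hE n)
  have := hw n
  gcongr

lemma qp_split (q : ℝ) (n : ℕ) : qp q q (5 * n) =
    qp (q ^ 5) q n * qp (q ^ 5) (q ^ 2) n * qp (q ^ 5) (q ^ 3) n * qp (q ^ 5) (q ^ 4) n *
      qp (q ^ 5) (q ^ 5) n := by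
  induction n with
  | zero => simp [qp_zero]
  | succ n ih =>
    rw [show 5 * (n + 1) = 5 * n + 1 + 1 + 1 + 1 + 1 by ring]
    simp only [qp_succ, ih]
    ring

lemma qpi_split (q : ℝ) (h0 : 0 < q) (h1 : q < 1) : qpi q q =
    qpi (q ^ 5) q * qpi (q ^ 5) (q ^ 2) * qpi (q ^ 5) (q ^ 3) * qpi (q ^ 5) (q ^ 4) *
      qpi (q ^ 5) (q ^ 5) := by
  have h0' : 0 < q ^ 5 := by positivity
  have h1' : q ^ 5 < 1 := pow_lt_one₀ h0.le h1 (by omega)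
  have t := fun a => qp_tendsto (q ^ 5) a h0' h1'
  have l := (qp_tendsto q q h0 h1).comp
    (tendsto_id.const_mul_atTop' (show 0 < 5 by omega) : Tendsto (fun n : ℕ => 5 * n) atTop atTop)
  refine tendsto_nhds_unique l ?_
  refine ((((t q).mul (t (q ^ 2))).mul (t (q ^ 3))).mul (t (q ^ 4))).mul (t (q ^ 5))
    |>.congr fun n => ?_
  simp [qp_split]

theorem rr_second_new_form (q : ℝ) (hq0 : 0 < q) (hq1 : q < 1) :
    1 / (qpi (q ^ 5) (q ^ 2) * qpi (q ^ 5) (q ^ 3)) =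
      qpi (q ^ 2) (-q ^ 3) *
        ∑' n : ℕ, q ^ (n ^ 2 + n) / (qp (q ^ 2) (q ^ 2) n * qp (q ^ 2) (-q ^ 3) n) := by
  have h0' : 0 < q ^ 2 := by positivity
  have h1' : q ^ 2 < 1 := by nlinarith
  have h05 : 0 < q ^ 5 := by positivity
  have h15 : q ^ 5 < 1 := pow_lt_one₀ hq0.le hq1 (by omega)
  have hx : -q ^ 3 < 1 := by have : 0 < q ^ 3 := by positivity
                             linarith
  have i1 := inv_tendsto q q hq0 hq1 hq1
  have i2 := inv_tendsto (q ^ 2) (q ^ 2) h0' h1' h1'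
  have i3 := inv_tendsto (q ^ 2) (-q ^ 3) h0' h1' hx
  have i5 := inv_tendsto (q ^ 5) (q ^ 5) h05 h15 h15
  have n1 := qpi_ne q q hq0 hq1 hq1
  have n2 := qpi_ne (q ^ 2) (q ^ 2) h0' h1' h1'
  have n5 := qpi_ne (q ^ 5) (q ^ 5) h05 h15 h15
  have s1 : Summable (fun n => q ^ (n ^ 2 + n) / qp q q n) := by
    obtain ⟨C, hC⟩ := bdd_of_tendsto _ _ i1
    refine (summ_of_bdd q hq0 hq1 (fun n => n ^ 2 + n) (fun n => by simp) _ C hC).congr fun n => ?_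
    rw [mul_one_div]
  have s2 : Summable (fun n => q ^ (n ^ 2 + n) /
      (qp (q ^ 2) (q ^ 2) n * qp (q ^ 2) (-q ^ 3) n)) := by
    obtain ⟨C, hC⟩ := bdd_of_tendsto _ _ (i2.mul i3)
    refine (summ_of_bdd q hq0 hq1 (fun n => n ^ 2 + n) (fun n => by simp) _ C hC).congr fun n => ?_
    rw [one_div_mul_one_div, mul_one_div]
  have s3 : Summable (fun r : ℕ =>
      (-1) ^ r * q ^ (5 * r.choose 2 + 4 * r) * (1 - q ^ (2 * r + 1))) := by
    refine (summ_of_bdd q hq0 hq1 (fun r => 5 * r.choose 2 + 4 * r) (fun n => by omega)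
      (fun r => (-1) ^ r * (1 - q ^ (2 * r + 1))) 1 (fun n => ?_)).congr fun n => by ring
    have a1 := pow_pos hq0 (2 * n + 1)
    have a2 := pow_le_one₀ (n := 2 * n + 1) hq0.le hq1.le
    rw [norm_mul, norm_pow, norm_neg, norm_one, one_pow, one_mul, Real.norm_eq_abs, abs_le]
    constructor <;> linarith
  set S := ∑' r : ℕ, (-1) ^ r * q ^ (5 * r.choose 2 + 4 * r) * (1 - q ^ (2 * r + 1)) with hS
  set G := ∑' n : ℕ, q ^ (n ^ 2 + n) / qp q q n with hG
  set H := ∑' n : ℕ, q ^ (n ^ 2 + n) / (qp (q ^ 2) (q ^ 2) n * qp (q ^ 2) (-q ^ 3) n) with hH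
  have E1 : H * (1 / qpi (q ^ 2) (q ^ 2)) * qpi (q ^ 2) (-q ^ 3) =
      G * (1 / qpi (q ^ 2) (q ^ 2)) * 1 := by
    have a := tann _ _ _ _ _ (fun _ => 0) s2 i2 (qp_tendsto (q ^ 2) (-q ^ 3) h0' h1')
    have b := tann _ _ (fun _ => 1) _ _ (fun _ => 0) s1 i2 tendsto_const_nhds
    refine tendsto_nhds_unique a (b.congr fun M => ?_)
    simpa using (finite_step q hq0 hq1 M).symm
  have E2 : G * (1 / qpi q q) * 1 = S * (1 / qpi q q) * (1 / qpi q q) := by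
    have a := tann _ _ (fun _ => 1) _ _ (fun _ => 0) s1 i1 tendsto_const_nhds
    have b := tann _ _ _ _ _ (fun r => r + 1) s3 i1 i1
    refine tendsto_nhds_unique a (b.congr fun M => ?_)
    have := (finite_rr q hq0 hq1 M).symm
    simp only [mul_one, mul_one_div, div_div]
    exact this
  have E3 : qpi (q ^ 5) q * qpi (q ^ 5) (q ^ 4) * (1 / qpi (q ^ 5) (q ^ 5)) =
      S * (1 / qpi (q ^ 5) (q ^ 5)) * (1 / qpi (q ^ 5) (q ^ 5)) := by
    have b := tann _ _ _ _ _ (fun r => r + 1) s3 i5 i5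
    have a := (((qp_tendsto (q ^ 5) q h05 h15).comp (tendsto_add_atTop_nat 1)).mul
      (qp_tendsto (q ^ 5) (q ^ 4) h05 h15)).mul (i5.comp
        (tendsto_atTop_mono (fun n : ℕ => (by omega : n ≤ 2 * n + 1)) tendsto_id))
    refine tendsto_nhds_unique a (b.congr fun M => ?_)
    have := (finite_jtp q hq0 hq1 M).symm
    simp only [mul_one_div, div_div, Function.comp_apply]
    exact this
  have sp := qpi_split q hq0 hq1
  have F1 : H * qpi (q ^ 2) (-q ^ 3) = G := by field_simp at E1; linarith
  have F2 : G * qpi q q = S := by field_simp at E2; linarith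
  have F3 : qpi (q ^ 5) q * qpi (q ^ 5) (q ^ 4) * qpi (q ^ 5) (q ^ 5) = S := by
    field_simp at E3; linarith
  rw [mul_comm (qpi (q ^ 2) (-q ^ 3)), F1]
  have n1' := n1
  rw [sp] at n1'
  have m2 : qpi (q ^ 5) (q ^ 2) ≠ 0 := fun h => n1' (by rw [h]; ring)
  have m3 : qpi (q ^ 5) (q ^ 3) ≠ 0 := fun h => n1' (by rw [h]; ring)
  rw [div_eq_iff (mul_ne_zero m2 m3)]
  apply mul_right_cancel₀ n1
  rw [one_mul]
  calc qpi q q = S * (qpi (q ^ 5) (q ^ 2) * qpi (q ^ 5) (q ^ 3)) := by rw [sp, ← F3]; ring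
    _ = _ := by rw [← F2]; ring
end

section
/- For 0 < q < 1 and all complex w, A_q(w) = (wq;q)_∞ ∑_{n=0}^∞ q^{3n²}(-w²)^n / ((q²;q²)_n (wq;q²)_n (wq²;q²)_n), provided wq is not of the form q^{-m} for a nonnegative integer m, where A_q(w) = ∑_{k=0}^∞ q^{k²}(-w)^k/(q;q)_k. -/
noncomputable def qpC (q a : ℂ) (n : ℕ) : ℂ := ∏ k ∈ Finset.range n, (1 - a * q ^ k)

noncomputable def qpiC (q a : ℂ) : ℂ := ∏' k : ℕ, (1 - a * q ^ k)

noncomputable def Aq (q : ℝ) (z : ℂ) : ℂ :=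
  ∑' k : ℕ, (q : ℂ) ^ (k ^ 2) * (-z) ^ k / qpC (q : ℂ) (q : ℂ) k

open Filter Topology

namespace AqAux

noncomputable def be (Q : ℂ) (k : ℕ) : ℂ := 1 / qpC Q Q k

noncomputable def al (Q : ℂ) (i : ℕ) : ℂ :=
  if Even i then (-1) ^ (i / 2) * Q ^ (2 * (i / 2).choose 2) / qpC (Q ^ 2) (Q ^ 2) (i / 2) else 0

lemma choose_succ_two (k : ℕ) : (k + 1).choose 2 = k + k.choose 2 := by
  rw [Nat.choose_succ_succ' k 1, Nat.choose_one_right]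

lemma sq_eq (m : ℕ) : m ^ 2 = (m + 1).choose 2 + m.choose 2 := by
  induction m with
  | zero => simp
  | succ m ih => rw [choose_succ_two (m + 1), choose_succ_two m] at *; nlinarith

lemma choose_add_two (i k : ℕ) :
    (i + k + 1).choose 2 = (i + 1).choose 2 + (k + 1).choose 2 + i * k := by
  induction k with
  | zero => simp
  | succ k ih =>
    rw [choose_succ_two (k + 1), show i + (k + 1) + 1 = (i + k + 1) + 1 from rfl,
      choose_succ_two (i + k + 1), ih]; ring

lemma exp_eq (n : ℕ) : 2 * n.choose 2 + (2 * n + 1).choose 2 = 3 * n ^ 2 := by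
  induction n with
  | zero => simp
  | succ n ih =>
    rw [show 2 * (n + 1) + 1 = (2 * n + 1 + 1) + 1 by ring, choose_succ_two (2 * n + 1 + 1),
      choose_succ_two (2 * n + 1), choose_succ_two n]; nlinarith

lemma one_sub_norm {Q : ℂ} (h1 : ‖Q‖ < 1) (k : ℕ) : 1 - ‖Q‖ ≤ ‖1 - Q ^ (k + 1)‖ := by
  have h : ‖Q ^ (k + 1)‖ ≤ ‖Q‖ := by
    rw [norm_pow]; exact pow_le_of_le_one (norm_nonneg _) h1.le (by omega)
  have := norm_sub_norm_le (1 : ℂ) (Q ^ (k + 1))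
  rw [norm_one] at this
  linarith

lemma one_sub_ne {Q : ℂ} (h1 : ‖Q‖ < 1) (k : ℕ) : 1 - Q ^ (k + 1) ≠ 0 := by
  have := one_sub_norm h1 k
  rw [← norm_pos_iff]; linarith

lemma qpC_succ (Q a : ℂ) (n : ℕ) : qpC Q a (n + 1) = qpC Q a n * (1 - a * Q ^ n) := by
  simp [qpC, Finset.prod_range_succ]

lemma qpC_norm {Q : ℂ} (h1 : ‖Q‖ < 1) (k : ℕ) : (1 - ‖Q‖) ^ k ≤ ‖qpC Q Q k‖ := by
  induction k with
  | zero => simp [qpC]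
  | succ k ih =>
    rw [qpC_succ, norm_mul, pow_succ, ← pow_succ']
    have := one_sub_norm h1 k
    gcongr

lemma qpC_ne {Q : ℂ} (h1 : ‖Q‖ < 1) (k : ℕ) : qpC Q Q k ≠ 0 := by
  have h := qpC_norm h1 k
  have : 0 < (1 - ‖Q‖) ^ k := pow_pos (by linarith) k
  rw [← norm_pos_iff]; linarith

lemma sq_lt {Q : ℂ} (h1 : ‖Q‖ < 1) : ‖Q ^ 2‖ < 1 := by
  rw [norm_pow]; exact pow_lt_one₀ (norm_nonneg _) h1 (by norm_num)

lemma be_norm {Q : ℂ} (h1 : ‖Q‖ < 1) (k : ℕ) : ‖be Q k‖ ≤ ((1 - ‖Q‖)⁻¹) ^ k := by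
  rw [be, norm_div, norm_one, inv_pow, one_div]
  exact inv_anti₀ (pow_pos (by linarith) k) (qpC_norm h1 k)

lemma be_succ {Q : ℂ} (h1 : ‖Q‖ < 1) (k : ℕ) : be Q (k + 1) * (1 - Q ^ (k + 1)) = be Q k := by
  have h2 := qpC_ne h1 k
  have h3 := one_sub_ne h1 k
  rw [be, be, qpC_succ, ← pow_succ']
  field_simp

lemma al_two (Q : ℂ) (n : ℕ) :
    al Q (2 * n) = (-1) ^ n * Q ^ (2 * n.choose 2) / qpC (Q ^ 2) (Q ^ 2) n := by
  simp [al]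

lemma al_odd (Q : ℂ) (n : ℕ) : al Q (2 * n + 1) = 0 := by
  simp [al]

lemma al_norm {Q : ℂ} (h1 : ‖Q‖ < 1) (i : ℕ) : ‖al Q i‖ ≤ ((1 - ‖Q‖)⁻¹) ^ i := by
  have hp : 0 < 1 - ‖Q‖ := by linarith
  obtain ⟨n, rfl | rfl⟩ := i.even_or_odd'
  · rw [al_two, norm_div, norm_mul, norm_pow, norm_neg, norm_one, one_pow, one_mul, inv_pow,
      ← one_div]
    have h2 := qpC_norm (sq_lt h1) n
    have h3 : (1 - ‖Q‖) ^ (2 * n) ≤ (1 - ‖Q ^ 2‖) ^ n := by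
      rw [pow_mul]
      apply pow_le_pow_left₀ (by positivity)
      rw [norm_pow]; nlinarith [norm_nonneg Q]
    have h4 : ‖Q ^ (2 * n.choose 2)‖ ≤ 1 := by
      rw [norm_pow]; exact pow_le_one₀ (norm_nonneg _) h1.le
    exact div_le_div₀ zero_le_one h4 (by positivity) (h3.trans h2)
  · rw [al_odd, norm_zero]; positivity

lemma al_succ {Q : ℂ} (h1 : ‖Q‖ < 1) (i : ℕ) :
    al Q (i + 2) = Q ^ (i + 2) * al Q (i + 2) - Q ^ i * al Q i := by
  obtain ⟨n, rfl | rfl⟩ := i.even_or_odd'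
  · rw [show 2 * n + 2 = 2 * (n + 1) by ring, al_two, al_two, qpC_succ, choose_succ_two]
    have h2 := qpC_ne (sq_lt h1) n
    have h3 := one_sub_ne (sq_lt h1) n
    rw [← pow_succ']
    have e1 : Q ^ (2 * (n + 1)) = (Q ^ 2) ^ (n + 1) := by rw [pow_mul]
    rw [e1]
    field_simp
    ring
  · rw [show 2 * n + 1 + 2 = 2 * (n + 1) + 1 by ring, al_odd, al_odd]; simp

open PowerSeries in
lemma conv {Q : ℂ} (h1 : ‖Q‖ < 1) (m : ℕ) :
    ∑ p ∈ (Finset.HasAntidiagonal.antidiagonal m), al Q p.1 * be Q p.2 = Q ^ (m.choose 2) * be Q m := by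
  set A : PowerSeries ℂ := PowerSeries.mk (al Q) with hA
  set B : PowerSeries ℂ := PowerSeries.mk (be Q) with hB
  have eA : A = (1 - X ^ 2) * rescale Q A := by
    ext i
    rw [sub_mul, one_mul, map_sub, coeff_rescale, coeff_X_pow_mul']
    rcases i with _ | _ | i
    · simp
    · have := al_odd Q 0
      simp at this
      simp [hA, this]
    · rw [if_pos (by omega), coeff_rescale]
      simp only [hA, coeff_mk]
      simpa using al_succ h1 i
  have eB : rescale Q B = (1 - X) * B := by
    ext i
    rw [sub_mul, one_mul, map_sub, coeff_rescale]
    rcases i with _ | i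
    · simp
    · rw [coeff_succ_X_mul]
      simp only [hB, coeff_mk]
      rw [← be_succ h1 i]; ring
  have hX : (1 - X : PowerSeries ℂ) ≠ 0 := by
    intro h
    have := congrArg (coeff 0) h
    simp at this
  have eG : (1 + X) * rescale Q (A * B) = A * B := by
    apply mul_left_cancel₀ hX
    have : (1 - X) * (A * B) = A * ((1 - X) * B) := by ring
    rw [this, ← eB, map_mul]
    nth_rewrite 2 [eA]
    ring
  have hg : ∀ m, coeff m (A * B) = Q ^ (m.choose 2) * be Q m := by
    intro m
    induction m with
    | zero => simp [hA, hB, al, be, qpC, coeff_zero_eq_constantCoeff]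
    | succ m ih =>
      have := congrArg (coeff (m + 1)) eG
      rw [add_mul, one_mul, map_add, coeff_succ_X_mul, coeff_rescale, coeff_rescale, ih] at this
      have h3 := one_sub_ne h1 m
      apply mul_left_cancel₀ h3
      rw [choose_succ_two, pow_add]
      rw [← be_succ h1 m] at this
      linear_combination -this
  rw [← hg, coeff_mul]
  simp [hA, hB]

lemma summ {p r : ℝ} (hp0 : 0 < p) (hp1 : p < 1) (hr : 0 ≤ r) :
    Summable fun k : ℕ => p ^ (k.choose 2) * r ^ k := by
  have key : Summable fun k : ℕ => p ^ (k.choose 2) * (r + 1) ^ k := by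
    refine summable_of_ratio_test_tendsto_lt_one (l := 0) zero_lt_one
      (Eventually.of_forall fun k => by positivity) ?_
    have : ∀ k : ℕ, ‖p ^ ((k + 1).choose 2) * (r + 1) ^ (k + 1)‖ / ‖p ^ (k.choose 2) * (r + 1) ^ k‖
        = p ^ k * (r + 1) := by
      intro k
      rw [Real.norm_of_nonneg (by positivity), Real.norm_of_nonneg (by positivity),
        choose_succ_two]
      field_simp
      ring
    simp_rw [this]
    simpa using (tendsto_pow_atTop_nhds_zero_of_lt_one hp0.le hp1).mul_const (r + 1)
  refine key.of_nonneg_of_le (fun k => by positivity) fun k => ?_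
  gcongr
  linarith

noncomputable def eT (Q : ℂ) (x : ℂ) (k : ℕ) : ℂ := Q ^ (k.choose 2) * be Q k * (-x) ^ k

noncomputable def E (Q : ℂ) (x : ℂ) : ℂ := ∑' k, eT Q x k

lemma eT_norm {Q : ℂ} (h1 : ‖Q‖ < 1) (x : ℂ) (k : ℕ) :
    ‖eT Q x k‖ ≤ ‖Q‖ ^ (k.choose 2) * ((1 - ‖Q‖)⁻¹ * ‖x‖) ^ k := by
  rw [eT, norm_mul, norm_mul, norm_pow, norm_pow, norm_neg, mul_pow, ← mul_assoc]
  gcongr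
  exact be_norm h1 k

lemma eT_summ {Q : ℂ} (h0 : 0 < ‖Q‖) (h1 : ‖Q‖ < 1) (x : ℂ) : Summable (eT Q x) := by
  have hp : 0 < 1 - ‖Q‖ := by linarith
  exact Summable.of_norm_bounded (summ h0 h1 (by positivity)) (eT_norm h1 x)

lemma E_fun {Q : ℂ} (h0 : 0 < ‖Q‖) (h1 : ‖Q‖ < 1) (x : ℂ) :
    E Q x = (1 - x) * E Q (x * Q) := by
  have s1 := eT_summ h0 h1 x
  have s2 := eT_summ h0 h1 (x * Q)
  have : E Q x - E Q (x * Q) = -x * E Q (x * Q) := by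
    rw [E, E, ← s1.tsum_sub s2, (s1.sub s2).tsum_eq_zero_add, ← tsum_mul_left]
    have z : eT Q x 0 - eT Q (x * Q) 0 = 0 := by simp [eT]
    rw [z, zero_add]
    congr 1
    ext k
    simp only [eT]
    rw [← be_succ h1 k, choose_succ_two]
    ring
  linear_combination this

lemma E_iter {Q : ℂ} (h0 : 0 < ‖Q‖) (h1 : ‖Q‖ < 1) (x : ℂ) (n : ℕ) :
    E Q x = qpC Q x n * E Q (x * Q ^ n) := by
  induction n with
  | zero => simp [qpC]
  | succ n ih =>
    rw [ih, E_fun h0 h1, qpC_succ, pow_succ]; ring_nf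

lemma E_lim {Q : ℂ} (h0 : 0 < ‖Q‖) (h1 : ‖Q‖ < 1) (x : ℂ) :
    Tendsto (fun n : ℕ => E Q (x * Q ^ n)) atTop (𝓝 1) := by
  have hp : 0 < 1 - ‖Q‖ := by linarith
  have e0 : ∑' k, eT Q 0 k = 1 := by
    rw [tsum_eq_single 0]
    · simp [eT, be, qpC]
    · intro k hk; simp [eT, hk]
  rw [← e0]
  refine tendsto_tsum_of_dominated_convergence
    (bound := fun k => ‖Q‖ ^ (k.choose 2) * ((1 - ‖Q‖)⁻¹ * ‖x‖) ^ k)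
    (summ h0 h1 (by positivity)) ?_ ?_
  · intro k
    have ht : Tendsto (fun n : ℕ => x * Q ^ n) atTop (𝓝 0) := by
      simpa using (tendsto_pow_atTop_nhds_zero_of_norm_lt_one h1).const_mul x
    have hc : Continuous fun y => eT Q y k := by unfold eT; fun_prop
    exact (hc.tendsto 0).comp ht
  · refine Eventually.of_forall fun n k => (eT_norm h1 _ k).trans ?_
    gcongr
    rw [norm_mul, norm_pow]
    exact mul_le_of_le_one_right (norm_nonneg _) (pow_le_one₀ (norm_nonneg _) h1.le)

lemma E_prod {Q : ℂ} (h0 : 0 < ‖Q‖) (h1 : ‖Q‖ < 1) (x : ℂ) : qpiC Q x = E Q x := by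
  have hm : Multipliable fun k : ℕ => (1 - x * Q ^ k) := by
    have : Summable fun k : ℕ => ‖-(x * Q ^ k)‖ := by
      simp only [norm_neg, norm_mul, norm_pow]
      exact (summable_geometric_of_lt_one (norm_nonneg _) h1).mul_left _
    simpa [sub_eq_add_neg] using multipliable_one_add_of_summable this
  have h2 : Tendsto (fun n => qpC Q x n) atTop (𝓝 (qpiC Q x)) := hm.hasProd.tendsto_prod_nat
  have h3 := h2.mul (E_lim h0 h1 x)
  simp only [← E_iter h0 h1 x] at h3
  rw [mul_one] at h3
  exact tendsto_nhds_unique h3 tendsto_const_nhds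

noncomputable def F (Q w : ℂ) (p : ℕ × ℕ) : ℂ :=
  al Q p.1 * be Q p.2 * (Q ^ ((p.1 + p.2 + 1).choose 2) * (-w) ^ (p.1 + p.2))

lemma F_summ {Q : ℂ} (h0 : 0 < ‖Q‖) (h1 : ‖Q‖ < 1) (w : ℂ) : Summable (F Q w) := by
  have hp : 0 < 1 - ‖Q‖ := by linarith
  have hs := summ h0 h1 (r := (1 - ‖Q‖)⁻¹ * ‖w‖) (by positivity)
  refine Summable.of_norm_bounded (hs.mul_of_nonneg hs (fun k => by positivity)
    (fun k => by positivity)) ?_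
  rintro ⟨i, k⟩
  simp only [F, norm_mul, norm_pow, norm_neg]
  have hQ : ‖Q‖ ^ ((i + k + 1).choose 2) ≤ ‖Q‖ ^ (i.choose 2 + k.choose 2) := by
    apply pow_le_pow_of_le_one (norm_nonneg _) h1.le
    rw [choose_add_two, choose_succ_two, choose_succ_two]
    have := Nat.zero_le (i * k)
    omega
  calc _ ≤ ((1 - ‖Q‖)⁻¹) ^ i * ((1 - ‖Q‖)⁻¹) ^ k *
        (‖Q‖ ^ (i.choose 2 + k.choose 2) * ‖w‖ ^ (i + k)) := by
        gcongr
        · exact al_norm h1 i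
        · exact be_norm h1 k
    _ = _ := by ring

lemma qpC_double (Q a : ℂ) (n : ℕ) :
    qpC (Q ^ 2) a n * qpC (Q ^ 2) (a * Q) n = qpC Q a (2 * n) := by
  induction n with
  | zero => simp [qpC]
  | succ n ih =>
    rw [show 2 * (n + 1) = 2 * n + 1 + 1 by ring, qpC_succ, qpC_succ, qpC_succ, qpC_succ, ← ih]
    ring

lemma left_eq {Q : ℂ} (h0 : 0 < ‖Q‖) (h1 : ‖Q‖ < 1) (w : ℂ) :
    ∑' p, F Q w p = ∑' k : ℕ, Q ^ (k ^ 2) * (-w) ^ k / qpC Q Q k := by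
  have hF := F_summ h0 h1 w
  rw [← Finset.HasAntidiagonal.sigmaAntidiagonalEquivProd.tsum_eq]
  change ∑' c, (F Q w ∘ Finset.HasAntidiagonal.sigmaAntidiagonalEquivProd) c = _
  rw [Summable.tsum_sigma' (fun n => (hasSum_fintype _).summable)
    (Finset.HasAntidiagonal.sigmaAntidiagonalEquivProd.summable_iff.mpr hF)]
  congr 1
  ext m
  rw [tsum_fintype]
  have : ∑ p ∈ (Finset.HasAntidiagonal.antidiagonal m), F Q w p = Q ^ (m ^ 2) * (-w) ^ m / qpC Q Q m := by
    have : ∀ p ∈ (Finset.HasAntidiagonal.antidiagonal m), F Q w p =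
        al Q p.1 * be Q p.2 * (Q ^ ((m + 1).choose 2) * (-w) ^ m) := by
      intro p hp
      rw [Finset.HasAntidiagonal.mem_antidiagonal] at hp
      rw [F, hp]
    rw [Finset.sum_congr rfl this, ← Finset.sum_mul, conv h1, sq_eq, be]
    ring
  rw [← this]
  exact Finset.sum_coe_sort (Finset.HasAntidiagonal.antidiagonal m) (F Q w)

lemma right_eq {Q : ℂ} (h0 : 0 < ‖Q‖) (h1 : ‖Q‖ < 1) (w : ℂ) :
    ∑' p, F Q w p = ∑' n : ℕ, Q ^ (3 * n ^ 2) * (-w ^ 2) ^ n / qpC (Q ^ 2) (Q ^ 2) n *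
      E Q (w * Q * Q ^ (2 * n)) := by
  have hF := F_summ h0 h1 w
  rw [hF.tsum_prod]
  have inner : ∀ i, ∑' k, F Q w (i, k) =
      al Q i * (Q ^ ((i + 1).choose 2) * (-w) ^ i) * E Q (w * Q * Q ^ i) := by
    intro i
    rw [E, ← tsum_mul_left]
    congr 1
    ext k
    simp only [F, eT]
    rw [choose_add_two, choose_succ_two k]
    ring
  simp_rw [inner]
  have inj : Function.Injective (fun n : ℕ => 2 * n) := fun a b h => by simpa using h
  rw [← inj.tsum_eq]
  · congr 1
    ext n
    rw [al_two, ← exp_eq, pow_add, pow_mul (-w), neg_sq, neg_pow (w ^ 2)]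
    ring
  · intro i hi
    obtain ⟨n, rfl | rfl⟩ := i.even_or_odd'
    · exact ⟨n, rfl⟩
    · simp [al_odd] at hi

end AqAux

theorem Aq_expansion_41 (q : ℝ) (hq0 : 0 < q) (hq1 : q < 1) (w : ℂ)
    (hw : ∀ m : ℕ, w * (q : ℂ) ≠ (q : ℂ) ^ (-(m : ℤ))) :
    Aq q w =
      qpiC (q : ℂ) (w * (q : ℂ)) *
        ∑' n : ℕ, (q : ℂ) ^ (3 * n ^ 2) * (-w ^ 2) ^ n /
          (qpC ((q : ℂ) ^ 2) ((q : ℂ) ^ 2) n * qpC ((q : ℂ) ^ 2) (w * (q : ℂ)) n *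
            qpC ((q : ℂ) ^ 2) (w * (q : ℂ) ^ 2) n) := by
  have hn : ‖(q : ℂ)‖ = q := by simp [abs_of_pos hq0]
  have h0 : 0 < ‖(q : ℂ)‖ := by rw [hn]; exact hq0
  have h1 : ‖(q : ℂ)‖ < 1 := by rw [hn]; exact hq1
  have hqne : (q : ℂ) ≠ 0 := norm_pos_iff.mp h0
  rw [Aq, ← AqAux.left_eq h0 h1, AqAux.right_eq h0 h1, AqAux.E_prod h0 h1, ← tsum_mul_left]
  congr 1
  ext n
  have e : w * (q : ℂ) ^ 2 = w * q * q := by ring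
  rw [mul_assoc (qpC ((q : ℂ) ^ 2) ((q : ℂ) ^ 2) n), e, AqAux.qpC_double,
    AqAux.E_iter h0 h1 (w * q) (2 * n)]
  have hne : qpC (q : ℂ) (w * q) (2 * n) ≠ 0 := by
    rw [qpC, Finset.prod_ne_zero_iff]
    intro k _ hk
    apply hw k
    rw [zpow_neg, zpow_natCast]
    exact eq_inv_of_mul_eq_one_left (sub_eq_zero.mp hk).symm
  have h2 := AqAux.qpC_ne (AqAux.sq_lt h1) n
  field_simp
end

section
/- For 0 < q < 1 and all complex w, A_q(w) = (-wq^{1/2};q)_∞ ∑_{n=0}^∞ q^{n(3n-1)/4}(-w)^n / ((q^{1/2};q^{1/2})_n (-wq^{1/2};q)_n), where A_q(w) = ∑_{k=0}^∞ q^{k²}(-w)^k/(q;q)_k, provided the denominators are nonzero. -/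
lemma two_choose_add (k : ℕ) : 2 * k.choose 2 + k = k ^ 2 := by
  induction k with
  | zero => rfl
  | succ n ih =>
    have : (n + 1).choose 2 = n + n.choose 2 := by
      rw [Nat.choose_succ_succ' n 1, Nat.choose_one_right]
    rw [this]; nlinarith

lemma choose_succ_two (n : ℕ) : (n + 1).choose 2 = n + n.choose 2 := by
  rw [Nat.choose_succ_succ' n 1, Nat.choose_one_right]

lemma expo_eq (n : ℕ) : n * (3 * n - 1) / 2 = n.choose 2 + n ^ 2 := by
  have h := two_choose_add n
  apply Nat.div_eq_of_eq_mul_left (by norm_num)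
  cases n with
  | zero => rfl
  | succ m =>
    have : 3 * (m + 1) - 1 = 3 * m + 2 := by omega
    rw [this]; nlinarith

lemma one_sub_pow_ne {Q : ℂ} (hQ : ‖Q‖ < 1) (k : ℕ) : 1 - Q ^ (k + 1) ≠ 0 := by
  intro h
  have h1 : Q ^ (k + 1) = 1 := (sub_eq_zero.mp h).symm
  have h2 : ‖Q‖ ^ (k + 1) = 1 := by rw [← norm_pow, h1, norm_one]
  have h3 := pow_lt_one₀ (norm_nonneg Q) hQ (Nat.succ_ne_zero k)
  exact h3.ne h2

lemma qpC_succ (Q : ℂ) (k : ℕ) : qpC Q Q (k + 1) = qpC Q Q k * (1 - Q ^ (k + 1)) := by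
  unfold qpC
  rw [Finset.prod_range_succ, pow_succ' Q k]

lemma qpC_ne {Q : ℂ} (hQ : ‖Q‖ < 1) (k : ℕ) : qpC Q Q k ≠ 0 := by
  induction k with
  | zero => simp [qpC]
  | succ n ih => rw [qpC_succ]; exact mul_ne_zero ih (one_sub_pow_ne hQ n)

noncomputable def eT (Q x : ℂ) (k : ℕ) : ℂ := Q ^ (k.choose 2) * x ^ k / qpC Q Q k

lemma eT_succ {Q : ℂ} (hQ : ‖Q‖ < 1) (x : ℂ) (k : ℕ) :
    eT Q x (k + 1) = (Q ^ k * x / (1 - Q ^ (k + 1))) * eT Q x k := by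
  have h1 := one_sub_pow_ne hQ k
  have h2 := qpC_ne hQ k
  unfold eT
  rw [qpC_succ, choose_succ_two]
  field_simp
  ring

lemma eT_summable {Q : ℂ} (hQ : ‖Q‖ < 1) (x : ℂ) : Summable (fun k => ‖eT Q x k‖) := by
  have ht : Filter.Tendsto (fun k : ℕ => Q ^ k * x / (1 - Q ^ (k + 1))) Filter.atTop (nhds 0) := by
    have h0 := tendsto_pow_atTop_nhds_zero_of_norm_lt_one hQ
    have h1 := (Filter.tendsto_add_atTop_iff_nat 1).mpr h0
    have := (h0.mul_const x).div (h1.const_sub 1) (by simp)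
    simp only [zero_mul, sub_zero, zero_div] at this
    exact this
  have ht2 := ht.norm
  rw [norm_zero] at ht2
  have hev := ht2.eventually (gt_mem_nhds (show (0 : ℝ) < 1 / 2 by norm_num))
  refine summable_of_ratio_norm_eventually_le (r := 1 / 2) (by norm_num) ?_
  filter_upwards [hev] with k hk
  rw [norm_norm, norm_norm, eT_succ hQ, norm_mul]
  gcongr

lemma eT_scale (Q x c : ℂ) (k : ℕ) : eT Q (c * x) k = c ^ k * eT Q x k := by
  unfold eT; rw [mul_pow]; ring

noncomputable def eS (Q x : ℂ) : ℂ := ∑' k, eT Q x k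

lemma eS_step {Q : ℂ} (hQ : ‖Q‖ < 1) (x : ℂ) : eS Q x = (1 + x) * eS Q (Q * x) := by
  have hs := (eT_summable hQ x).of_norm
  have hs' := (eT_summable hQ (Q * x)).of_norm
  have key : ∀ k, eT Q x (k + 1) = eT Q (Q * x) (k + 1) + x * eT Q (Q * x) k := by
    intro k
    rw [eT_scale, eT_scale, eT_succ hQ]
    have h1 := one_sub_pow_ne hQ k
    field_simp
    ring
  have h0 : ∀ y, eT Q y 0 = 1 := by intro y; simp [eT, qpC]
  unfold eS
  rw [hs.tsum_eq_zero_add, add_mul, one_mul]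
  conv_rhs => rw [hs'.tsum_eq_zero_add]
  rw [tsum_congr key, Summable.tsum_add ((summable_nat_add_iff 1).mpr hs') (hs'.mul_left x),
    tsum_mul_left, h0, h0]
  rw [hs'.tsum_eq_zero_add, h0]
  ring

lemma eS_iter {Q : ℂ} (hQ : ‖Q‖ < 1) (x : ℂ) (n : ℕ) :
    eS Q x = qpC Q (-x) n * eS Q (Q ^ n * x) := by
  induction n with
  | zero => simp [qpC]
  | succ n ih =>
    rw [ih, eS_step hQ]
    have : qpC Q (-x) (n + 1) = qpC Q (-x) n * (1 + Q ^ n * x) := by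
      unfold qpC; rw [Finset.prod_range_succ]; ring
    rw [this, show Q * (Q ^ n * x) = Q ^ (n + 1) * x by ring]
    ring

lemma eS_tendsto {Q : ℂ} (hQ : ‖Q‖ < 1) (x : ℂ) :
    Filter.Tendsto (fun n : ℕ => eS Q (Q ^ n * x)) Filter.atTop (nhds 1) := by
  have h1 : (1 : ℂ) = ∑' k : ℕ, if k = 0 then 1 else 0 := by simp
  rw [h1]
  unfold eS
  refine tendsto_tsum_of_dominated_convergence (eT_summable hQ x) ?_ ?_
  · intro k
    simp only [eT_scale]
    rcases Nat.eq_zero_or_pos k with rfl | hk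
    · simp [eT, qpC]
    · rw [if_neg hk.ne']
      have h0 := tendsto_pow_atTop_nhds_zero_of_norm_lt_one hQ
      have := (h0.pow k).mul_const (eT Q x k)
      simpa [hk.ne'] using this
  · refine Filter.Eventually.of_forall fun n k => ?_
    rw [eT_scale, norm_mul, norm_pow, norm_pow]
    exact mul_le_of_le_one_left (norm_nonneg _)
      (pow_le_one₀ (by positivity) (pow_le_one₀ (norm_nonneg _) hQ.le))

lemma qpiC_eq {Q : ℂ} (hQ : ‖Q‖ < 1) (x : ℂ) : qpiC Q (-x) = eS Q x := by
  have hm : Multipliable (fun k : ℕ => 1 - (-x) * Q ^ k) := by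
    have : Summable (fun k : ℕ => ‖x * Q ^ k‖) := by
      simp only [norm_mul, norm_pow]
      exact (summable_geometric_of_lt_one (norm_nonneg _) hQ).mul_left _
    have := multipliable_one_add_of_summable this
    simpa using this
  have h1 := hm.hasProd.tendsto_prod_nat
  have h2 := h1.mul (eS_tendsto hQ x)
  rw [mul_one] at h2
  have h3 : Filter.Tendsto (fun _ : ℕ => eS Q x) Filter.atTop (nhds (qpiC Q (-x))) := by
    refine h2.congr fun n => ?_
    exact (eS_iter hQ x n).symm
  exact tendsto_nhds_unique h3 tendsto_const_nhds

open PowerSeries in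
lemma coeff_id {p : ℂ} (hp : ‖p‖ < 1) (hQ : ‖p ^ 2‖ < 1) (N : ℕ) :
    ∑ ij ∈ Finset.HasAntidiagonal.antidiagonal N, eT p 1 ij.1 * ((-1) ^ ij.2 / qpC (p ^ 2) (p ^ 2) ij.2)
      = p ^ (N ^ 2) / qpC (p ^ 2) (p ^ 2) N := by
  set F : PowerSeries ℂ := PowerSeries.mk (fun n => eT p 1 n) with hF
  set G : PowerSeries ℂ := PowerSeries.mk (fun j => (-1) ^ j / qpC (p ^ 2) (p ^ 2) j) with hG
  have hF1 : F = (1 + X) * rescale p F := by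
    ext n
    cases n with
    | zero =>
      rw [add_mul, one_mul, map_add, coeff_zero_X_mul, coeff_rescale]
      simp
    | succ n =>
      rw [add_mul, one_mul, map_add, coeff_succ_X_mul]
      simp only [coeff_rescale, hF, coeff_mk]
      rw [eT_succ hp]
      have h1 := one_sub_pow_ne hp n
      field_simp
      ring
  have hF2 : F = (1 + X) * (1 + C p * X) * rescale (p ^ 2) F := by
    have h2 : rescale p F = (1 + C p * X) * rescale (p ^ 2) F := by
      conv_lhs => rw [hF1]
      rw [map_mul, rescale_rescale, ← sq, map_add, map_one, rescale_X]
    conv_lhs => rw [hF1, h2]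
    ring
  have hG1 : (1 + X) * G = rescale (p ^ 2) G := by
    ext n
    cases n with
    | zero =>
      rw [add_mul, one_mul, map_add, coeff_zero_X_mul, coeff_rescale]
      simp
    | succ n =>
      rw [add_mul, one_mul, map_add, coeff_succ_X_mul]
      simp only [coeff_rescale, hG, coeff_mk]
      rw [qpC_succ]
      have h1 := one_sub_pow_ne hQ n
      have h2 := qpC_ne hQ n
      field_simp
      ring
  have hH : F * G = (1 + C p * X) * rescale (p ^ 2) (F * G) := by
    rw [map_mul, ← hG1]
    conv_lhs => rw [hF2]
    ring
  have hc : ∀ M, coeff M (F * G) = p ^ (M ^ 2) / qpC (p ^ 2) (p ^ 2) M := by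
    intro M
    induction M with
    | zero => simp [hF, hG, eT, qpC, coeff_zero_eq_constantCoeff]
    | succ n ih =>
      have h := congrArg (coeff (n + 1)) hH
      rw [add_mul, one_mul, map_add, mul_assoc, coeff_C_mul, coeff_succ_X_mul, coeff_rescale,
        coeff_rescale, ih] at h
      have h1 := one_sub_pow_ne hQ n
      have h2 := qpC_ne hQ n
      rw [qpC_succ]
      have h3 : coeff (n + 1) (F * G) * (1 - (p ^ 2) ^ (n + 1)) =
          p * ((p ^ 2) ^ n * (p ^ n ^ 2 / qpC (p ^ 2) (p ^ 2) n)) := by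
        linear_combination h
      rw [eq_div_iff (mul_ne_zero h2 h1)]
      calc _ = (coeff (n + 1) (F * G) * (1 - (p ^ 2) ^ (n + 1))) * qpC (p ^ 2) (p ^ 2) n := by ring
        _ = _ := by
          rw [h3]
          field_simp
          ring
  rw [← hc N, coeff_mul]
  simp [hF, hG]

lemma main_p {p : ℂ} (hp : ‖p‖ < 1) (w : ℂ)
    (hden : ∀ n : ℕ, qpC (p ^ 2) (-w * p) n ≠ 0) :
    ∑' k : ℕ, (p ^ 2) ^ (k ^ 2) * (-w) ^ k / qpC (p ^ 2) (p ^ 2) k =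
      qpiC (p ^ 2) (-w * p) *
        ∑' n : ℕ, p ^ (n * (3 * n - 1) / 2) * (-w) ^ n /
          (qpC p p n * qpC (p ^ 2) (-w * p) n) := by
  have hQ : ‖p ^ 2‖ < 1 := by
    rw [norm_pow]; exact pow_lt_one₀ (norm_nonneg _) hp two_ne_zero
  have hneg : -w * p = -(w * p) := by ring
  set f : ℕ × ℕ → ℂ := fun ij =>
    p ^ (ij.1 ^ 2) * eT p (-w) ij.1 * eT (p ^ 2) ((p ^ 2) ^ ij.1 * (w * p)) ij.2 with hf
  have hsum : Summable f := by
    refine Summable.of_norm_bounded ((eT_summable hp (-w)).mul_of_nonneg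
      (eT_summable hQ (w * p)) (fun _ => norm_nonneg _) (fun _ => norm_nonneg _)) ?_
    rintro ⟨n, j⟩
    simp only [hf]
    rw [eT_scale, norm_mul, norm_mul, norm_mul]
    simp only [norm_pow]
    gcongr
    · exact mul_le_of_le_one_left (norm_nonneg _) (pow_le_one₀ (norm_nonneg _) hp.le)
    · refine mul_le_of_le_one_left (norm_nonneg _) (pow_le_one₀ (by positivity)
        (pow_le_one₀ (by positivity) (pow_le_one₀ (norm_nonneg _) hp.le)))
  have hR : qpiC (p ^ 2) (-w * p) *
        ∑' n : ℕ, p ^ (n * (3 * n - 1) / 2) * (-w) ^ n /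
          (qpC p p n * qpC (p ^ 2) (-w * p) n) = ∑' ij, f ij := by
    rw [hsum.tsum_prod, ← tsum_mul_left]
    refine tsum_congr fun n => ?_
    simp only [hf]
    rw [tsum_mul_left]
    change _ = _ * eS _ _
    have hd := hden n
    rw [hneg] at hd ⊢
    rw [qpiC_eq hQ, eS_iter hQ (w * p) n, expo_eq, pow_add]
    have h2 := qpC_ne hp n
    unfold eT
    generalize qpC (p ^ 2) (-(w * p)) n = D at *
    generalize eS (p ^ 2) ((p ^ 2) ^ n * (w * p)) = E at *
    field_simp
  rw [hR, ← (Finset.HasAntidiagonal.sigmaAntidiagonalEquivProd (A := ℕ)).tsum_eq f]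
  have hsum' := (Finset.HasAntidiagonal.sigmaAntidiagonalEquivProd (A := ℕ)).summable_iff.mpr hsum
  refine Eq.trans ?_ (Summable.tsum_sigma' (fun n => (hasSum_fintype _).summable) hsum').symm
  refine tsum_congr fun N => ?_
  rw [tsum_fintype]
  have hcs : ∑ i : {x // x ∈ (Finset.HasAntidiagonal.antidiagonal N : Finset (ℕ × ℕ))}, f i.1 =
      ∑ ij ∈ Finset.HasAntidiagonal.antidiagonal N, f ij := Finset.sum_coe_sort _ f
  refine Eq.trans ?_ hcs.symm
  have hterm : ∀ ij ∈ Finset.HasAntidiagonal.antidiagonal N, f ij = (p ^ (N ^ 2) * (-w) ^ N) *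
      (eT p 1 ij.1 * ((-1) ^ ij.2 / qpC (p ^ 2) (p ^ 2) ij.2)) := by
    rintro ⟨n, j⟩ h
    rw [Finset.HasAntidiagonal.mem_antidiagonal] at h
    simp only at h
    subst h
    simp only [hf]
    unfold eT
    have e1 : p ^ ((n + j) ^ 2) = p ^ (n ^ 2) * ((p ^ 2) ^ (j.choose 2) * (((p ^ 2) ^ n) ^ j * p ^ j)) := by
      have := two_choose_add j
      simp only [← pow_mul, ← pow_add]
      congr 1
      nlinarith
    have e2 : (-w) ^ (n + j) * (-1) ^ j = (-w) ^ n * w ^ j := by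
      rw [pow_add, mul_assoc, ← mul_pow]; simp
    rw [e1, mul_pow, mul_pow, one_pow]
    linear_combination (-(p ^ (n ^ 2) * ((p ^ 2) ^ (j.choose 2) * (((p ^ 2) ^ n) ^ j * p ^ j)) *
      p ^ (n.choose 2) / qpC p p n / qpC (p ^ 2) (p ^ 2) j)) * e2
  rw [Finset.sum_congr rfl hterm, ← Finset.mul_sum, coeff_id hp hQ]
  rw [← pow_mul, two_mul, pow_add]
  ring

theorem Aq_expansion_42 (q : ℝ) (hq0 : 0 < q) (hq1 : q < 1) (w : ℂ)
    (hden : ∀ n : ℕ, qpC (q : ℂ) (-w * (Real.sqrt q : ℂ)) n ≠ 0) :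
    Aq q w =
      qpiC (q : ℂ) (-w * (Real.sqrt q : ℂ)) *
        ∑' n : ℕ, (Real.sqrt q : ℂ) ^ (n * (3 * n - 1) / 2) * (-w) ^ n /
          (qpC (Real.sqrt q : ℂ) (Real.sqrt q : ℂ) n *
            qpC (q : ℂ) (-w * (Real.sqrt q : ℂ)) n) := by
  have hp : ‖(Real.sqrt q : ℂ)‖ < 1 := by
    rw [Complex.norm_real, Real.norm_of_nonneg (Real.sqrt_nonneg q)]
    rw [Real.sqrt_lt' one_pos]; simpa using hq1
  have hq : (q : ℂ) = (Real.sqrt q : ℂ) ^ 2 := by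
    rw [← Complex.ofReal_pow, Real.sq_sqrt hq0.le]
  unfold Aq
  generalize (Real.sqrt q : ℂ) = p at *
  rw [hq] at hden ⊢
  exact main_p hp w hden
end
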